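/- arXiv:1912.10904 — 2 statements merged into one kernel-verified Lean document; each statement's English description precedes it below -/
import Mathlib

section
/- For n, m ∈ ℕ define φ_{n,m} : ℂ → ℂ by φ_{n,m}(z) = (π n! m!)^{−1/2} · ((z̄ − ∂_z)^n (w ↦ w^m))(z) · e^{−|z|²/2}. Then the family {φ_{n,m}} is orthonormal in L²(ℂ): for all n, m, n′, m′ ∈ ℕ, ∫_ℂ conj(φ_{n′,m′}(z)) · φ_{n,m}(z) d²z equals 1 if (n,m) = (n′,m′) and 0 otherwise. -/
open MeasureTheory

noncomputable section

/-- Wirtinger derivative `∂_z F = ½(∂_x F − i ∂_y F)`. -/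
def dz (F : ℂ → ℂ) (z : ℂ) : ℂ :=
  (1 / 2 : ℂ) * (fderiv ℝ F z 1 - Complex.I * fderiv ℝ F z Complex.I)

/-- The operator `z̄ − ∂_z`. -/
def Tbar (F : ℂ → ℂ) : ℂ → ℂ := fun z => (starRingEnd ℂ) z * F z - dz F z

/-- The Landau-level basis function
`φ_{n,m}(z) = (π n! m!)^{−1/2} ((z̄ − ∂_z)^n (w ↦ w^m))(z) e^{−|z|²/2}` (units `B = 2`). -/
def phi (n m : ℕ) (z : ℂ) : ℂ :=
  (Real.sqrt (Real.pi * n.factorial * m.factorial) : ℂ)⁻¹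
    * (Tbar^[n] (fun w => w ^ m)) z * Complex.exp (-(Complex.normSq z : ℂ) / 2)

open scoped ComplexConjugate

/-- Wirtinger derivative `∂_{z̄} F = ½(∂_x F + i ∂_y F)`. -/
def dzbar (F : ℂ → ℂ) (z : ℂ) : ℂ :=
  (1 / 2 : ℂ) * (fderiv ℝ F z 1 + Complex.I * fderiv ℝ F z Complex.I)

/-- The monomial `z̄^a z^b`. -/
def wirtingerMonomial (a b : ℕ) (z : ℂ) : ℂ := conj z ^ a * z ^ b

/-- The polynomial functions in `z` and `z̄`. -/
def wirtingerPoly : Submodule ℂ (ℂ → ℂ) :=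
  Submodule.span ℂ (Set.range fun p : ℕ × ℕ => wirtingerMonomial p.1 p.2)

/-- The Gaussian integral `∫ F(z) e^{−|z|²} d²z`. -/
def gaussInt (F : ℂ → ℂ) : ℂ := ∫ z : ℂ, F z * (Real.exp (-‖z‖ ^ 2) : ℂ)

lemma wirtingerMonomial_mem (a b : ℕ) : wirtingerMonomial a b ∈ wirtingerPoly :=
  Submodule.subset_span ⟨(a, b), rfl⟩

@[elab_as_elim]
lemma wirtingerPoly_induction {P : ∀ F : ℂ → ℂ, F ∈ wirtingerPoly → Prop}
    (mono : ∀ a b, P (wirtingerMonomial a b) (wirtingerMonomial_mem a b))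
    (add : ∀ F hF H hH, P F hF → P H hH → P (F + H) (add_mem hF hH))
    (smul : ∀ c F hF, P F hF → P (c • F) (Submodule.smul_mem _ c hF))
    {F : ℂ → ℂ} (hF : F ∈ wirtingerPoly) : P F hF := by
  refine Submodule.span_induction (p := P) ?_ ?_ ?_ ?_ hF
  · rintro _ ⟨p, rfl⟩
    exact mono p.1 p.2
  · simpa using smul 0 _ (wirtingerMonomial_mem 0 0) (mono 0 0)
  · exact fun F H hF hH => add F hF H hH
  · exact fun c F hF => smul c F hF

lemma hasFDerivAt_wirtingerMonomial (a b : ℕ) (z : ℂ) :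
    HasFDerivAt (wirtingerMonomial a b)
      ((a * conj z ^ (a - 1) * z ^ b) • (Complex.conjCLE : ℂ →L[ℝ] ℂ)
        + (b * conj z ^ a * z ^ (b - 1)) • ContinuousLinearMap.id ℝ ℂ) z := by
  have h1 : HasFDerivAt (fun w : ℂ => conj w) (Complex.conjCLE : ℂ →L[ℝ] ℂ) z :=
    Complex.conjCLE.hasFDerivAt
  refine ((h1.pow a).mul ((hasFDerivAt_id (𝕜 := ℝ) z).pow b)).congr_fderiv ?_
  ext
  simp
  ring

lemma differentiable_of_mem {F : ℂ → ℂ} (hF : F ∈ wirtingerPoly) : Differentiable ℝ F := by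
  induction hF using wirtingerPoly_induction with
  | mono a b => exact fun z => (hasFDerivAt_wirtingerMonomial a b z).differentiableAt
  | add F _ H _ h1 h2 => exact h1.add h2
  | smul c F _ h => exact h.const_smul c

lemma dz_wirtingerMonomial (a b : ℕ) :
    dz (wirtingerMonomial a b) = (b : ℂ) • wirtingerMonomial a (b - 1) := by
  funext z
  simp [dz, (hasFDerivAt_wirtingerMonomial a b z).fderiv, wirtingerMonomial]
  linear_combination (a * conj z ^ (a - 1) * z ^ b - b * conj z ^ a * z ^ (b - 1)) / 2
    * Complex.I_sq

lemma dzbar_wirtingerMonomial (a b : ℕ) :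
    dzbar (wirtingerMonomial a b) = (a : ℂ) • wirtingerMonomial (a - 1) b := by
  funext z
  simp [dzbar, (hasFDerivAt_wirtingerMonomial a b z).fderiv, wirtingerMonomial]
  linear_combination (- a * conj z ^ (a - 1) * z ^ b + b * conj z ^ a * z ^ (b - 1)) / 2
    * Complex.I_sq

lemma dz_add {F H : ℂ → ℂ} (hF : Differentiable ℝ F) (hH : Differentiable ℝ H) :
    dz (F + H) = dz F + dz H := by
  funext z
  simp [dz, fderiv_add (hF z) (hH z)]
  ring

lemma dzbar_add {F H : ℂ → ℂ} (hF : Differentiable ℝ F) (hH : Differentiable ℝ H) :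
    dzbar (F + H) = dzbar F + dzbar H := by
  funext z
  simp [dzbar, fderiv_add (hF z) (hH z)]
  ring

lemma dz_smul (c : ℂ) {F : ℂ → ℂ} (hF : Differentiable ℝ F) : dz (c • F) = c • dz F := by
  funext z
  simp [dz, fderiv_const_smul (hF z)]
  ring

lemma dzbar_smul (c : ℂ) {F : ℂ → ℂ} (hF : Differentiable ℝ F) :
    dzbar (c • F) = c • dzbar F := by
  funext z
  simp [dzbar, fderiv_const_smul (hF z)]
  ring

lemma dzbar_mul {F H : ℂ → ℂ} (hF : Differentiable ℝ F) (hH : Differentiable ℝ H) :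
    dzbar (F * H) = dzbar F * H + F * dzbar H := by
  funext z
  simp [dzbar, fderiv_mul (hF z) (hH z)]
  ring

lemma dzbar_conj {F : ℂ → ℂ} (hF : Differentiable ℝ F) : dzbar (conj F) = conj (dz F) := by
  funext z
  have h : HasFDerivAt (conj F) ((Complex.conjCLE : ℂ →L[ℝ] ℂ).comp (fderiv ℝ F z)) z :=
    Complex.conjCLE.hasFDerivAt.comp z (hF z).hasFDerivAt
  simp [dzbar, dz, h.fderiv, Complex.conj_ofNat]

lemma Tbar_add {F H : ℂ → ℂ} (hF : Differentiable ℝ F) (hH : Differentiable ℝ H) :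
    Tbar (F + H) = Tbar F + Tbar H := by
  funext z
  simp [Tbar, dz_add hF hH]
  ring

lemma Tbar_smul (c : ℂ) {F : ℂ → ℂ} (hF : Differentiable ℝ F) :
    Tbar (c • F) = c • Tbar F := by
  funext z
  simp [Tbar, dz_smul c hF]
  ring

lemma Tbar_wirtingerMonomial (a b : ℕ) :
    Tbar (wirtingerMonomial a b)
      = wirtingerMonomial (a + 1) b + (-b : ℂ) • wirtingerMonomial a (b - 1) := by
  funext z
  simp [Tbar, dz_wirtingerMonomial, wirtingerMonomial]
  ring

lemma Tbar_mem {F : ℂ → ℂ} (hF : F ∈ wirtingerPoly) : Tbar F ∈ wirtingerPoly := by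
  induction hF using wirtingerPoly_induction with
  | mono a b =>
    rw [Tbar_wirtingerMonomial]
    exact add_mem (wirtingerMonomial_mem _ _)
      (Submodule.smul_mem _ _ (wirtingerMonomial_mem _ _))
  | add F hF H hH h1 h2 =>
    rw [Tbar_add (differentiable_of_mem hF) (differentiable_of_mem hH)]
    exact add_mem h1 h2
  | smul c F hF h =>
    rw [Tbar_smul c (differentiable_of_mem hF)]
    exact Submodule.smul_mem _ _ h

lemma dzbar_mem {F : ℂ → ℂ} (hF : F ∈ wirtingerPoly) : dzbar F ∈ wirtingerPoly := by
  induction hF using wirtingerPoly_induction with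
  | mono a b =>
    rw [dzbar_wirtingerMonomial]
    exact Submodule.smul_mem _ _ (wirtingerMonomial_mem _ _)
  | add F hF H hH h1 h2 =>
    rw [dzbar_add (differentiable_of_mem hF) (differentiable_of_mem hH)]
    exact add_mem h1 h2
  | smul c F hF h =>
    rw [dzbar_smul c (differentiable_of_mem hF)]
    exact Submodule.smul_mem _ _ h

lemma conj_mem {F : ℂ → ℂ} (hF : F ∈ wirtingerPoly) : conj F ∈ wirtingerPoly := by
  induction hF using wirtingerPoly_induction with
  | mono a b =>
    convert wirtingerMonomial_mem b a using 1
    funext z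
    simp [wirtingerMonomial, mul_comm]
  | add F _ H _ h1 h2 =>
    rw [map_add]
    exact add_mem h1 h2
  | smul c F _ h =>
    convert Submodule.smul_mem _ (conj c) h using 1
    funext z
    simp

lemma mul_mem_wirtingerPoly {F H : ℂ → ℂ} (hF : F ∈ wirtingerPoly) (hH : H ∈ wirtingerPoly) :
    F * H ∈ wirtingerPoly := by
  induction hF using wirtingerPoly_induction with
  | mono a b =>
    induction hH using wirtingerPoly_induction with
    | mono c d =>
      convert wirtingerMonomial_mem (a + c) (b + d) using 1
      funext z
      simp [wirtingerMonomial]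
      ring
    | add F _ H _ h1 h2 =>
      rw [mul_add]
      exact add_mem h1 h2
    | smul c F _ h =>
      rw [mul_smul_comm]
      exact Submodule.smul_mem _ _ h
  | add F _ H _ h1 h2 =>
    rw [add_mul]
    exact add_mem h1 h2
  | smul c F _ h =>
    rw [smul_mul_assoc]
    exact Submodule.smul_mem _ _ h

lemma dzbar_Tbar {F : ℂ → ℂ} (hF : F ∈ wirtingerPoly) :
    dzbar (Tbar F) = F + Tbar (dzbar F) := by
  induction hF using wirtingerPoly_induction with
  | mono a b =>
    have hd (a b : ℕ) := differentiable_of_mem (wirtingerMonomial_mem a b)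
    rw [Tbar_wirtingerMonomial, dzbar_add (hd _ _) ((hd _ _).const_smul _),
      dzbar_smul _ (hd _ _), dzbar_wirtingerMonomial, dzbar_wirtingerMonomial,
      dzbar_wirtingerMonomial, Tbar_smul _ (hd _ _), Tbar_wirtingerMonomial]
    funext z
    rcases a with _ | a
    · simp [wirtingerMonomial]
    · simp [wirtingerMonomial]
      ring
  | add F hF H hH h1 h2 =>
    have hd := @differentiable_of_mem
    rw [Tbar_add (hd hF) (hd hH), dzbar_add (hd (Tbar_mem hF)) (hd (Tbar_mem hH)),
      dzbar_add (hd hF) (hd hH), Tbar_add (hd (dzbar_mem hF)) (hd (dzbar_mem hH)), h1, h2]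
    abel
  | smul c F hF h =>
    have hd := @differentiable_of_mem
    rw [Tbar_smul c (hd hF), dzbar_smul c (hd (Tbar_mem hF)), dzbar_smul c (hd hF),
      Tbar_smul c (hd (dzbar_mem hF)), h, smul_add]

lemma Tbar_iterate_mem (n m : ℕ) : Tbar^[n] (wirtingerMonomial 0 m) ∈ wirtingerPoly := by
  induction n with
  | zero => exact wirtingerMonomial_mem 0 m
  | succ n ih =>
    rw [Function.iterate_succ_apply']
    exact Tbar_mem ih

lemma dzbar_wirtingerMonomial_zero (m : ℕ) : dzbar (wirtingerMonomial 0 m) = 0 := by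
  simp [dzbar_wirtingerMonomial]

lemma dzbar_Tbar_iterate_succ (n m : ℕ) :
    dzbar (Tbar^[n + 1] (wirtingerMonomial 0 m))
      = ((n : ℂ) + 1) • Tbar^[n] (wirtingerMonomial 0 m) := by
  induction n with
  | zero =>
    have h : Tbar 0 = 0 := by
      simpa using Tbar_smul 0 (differentiable_of_mem (wirtingerMonomial_mem 0 0))
    simp [dzbar_Tbar (wirtingerMonomial_mem 0 m), dzbar_wirtingerMonomial_zero, h]
  | succ n ih =>
    rw [Function.iterate_succ_apply', dzbar_Tbar (Tbar_iterate_mem _ _), ih,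
      Tbar_smul _ (differentiable_of_mem (Tbar_iterate_mem _ _)),
      ← Function.iterate_succ_apply' Tbar]
    push_cast
    module

lemma norm_wirtingerMonomial (a b : ℕ) (z : ℂ) :
    ‖wirtingerMonomial a b z‖ = ‖z‖ ^ (a + b) := by
  simp [wirtingerMonomial, pow_add]

lemma integral_norm_pow_mul_exp (k : ℕ) :
    ∫ z : ℂ, ‖z‖ ^ k * Real.exp (-‖z‖ ^ 2) = Real.pi * Real.Gamma (((k : ℝ) + 2) / 2) := by
  have h := Complex.integral_rpow_mul_exp_neg_rpow (p := 2) (q := k) (by norm_num)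
    (by have : (0 : ℝ) ≤ k := k.cast_nonneg
        linarith)
  simpa using h

lemma integrable_wirtingerMonomial (a b : ℕ) :
    Integrable fun z : ℂ => wirtingerMonomial a b z * (Real.exp (-‖z‖ ^ 2) : ℂ) := by
  have h : Integrable fun z : ℂ => ‖z‖ ^ (a + b) * Real.exp (-‖z‖ ^ 2) := by
    by_contra hn
    have h0 := integral_undef hn
    rw [integral_norm_pow_mul_exp] at h0
    have : 0 < Real.Gamma ((((a + b : ℕ) : ℝ) + 2) / 2) := Real.Gamma_pos_of_pos (by positivity)
    exact (mul_pos Real.pi_pos this).ne' h0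
  refine h.mono' ?_ (.of_forall fun z => ?_)
  · refine Continuous.aestronglyMeasurable ?_
    unfold wirtingerMonomial
    fun_prop
  · rw [norm_mul, norm_wirtingerMonomial, Complex.norm_real, Real.norm_eq_abs, Real.abs_exp]

lemma integrable_of_mem {F : ℂ → ℂ} (hF : F ∈ wirtingerPoly) :
    Integrable fun z : ℂ => F z * (Real.exp (-‖z‖ ^ 2) : ℂ) := by
  induction hF using wirtingerPoly_induction with
  | mono a b => exact integrable_wirtingerMonomial a b
  | add F _ H _ h1 h2 =>
    simp only [Pi.add_apply, add_mul]
    exact h1.add h2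
  | smul c F _ h => simpa only [Pi.smul_apply, smul_eq_mul, mul_assoc] using h.const_mul c

lemma gaussInt_add {F H : ℂ → ℂ} (hF : F ∈ wirtingerPoly) (hH : H ∈ wirtingerPoly) :
    gaussInt (F + H) = gaussInt F + gaussInt H := by
  simp only [gaussInt, Pi.add_apply, add_mul]
  exact integral_add (integrable_of_mem hF) (integrable_of_mem hH)

lemma gaussInt_smul (c : ℂ) (F : ℂ → ℂ) : gaussInt (c • F) = c * gaussInt F := by
  simp only [gaussInt, Pi.smul_apply, smul_eq_mul, mul_assoc]
  exact integral_const_mul _ _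

lemma gaussInt_zero : gaussInt 0 = 0 := by
  simp [gaussInt]

lemma gaussInt_conj (F : ℂ → ℂ) : gaussInt (conj F) = conj (gaussInt F) := by
  simp only [gaussInt]
  rw [← integral_conj]
  simp only [map_mul, Complex.conj_ofReal]
  rfl

lemma gaussInt_wirtingerMonomial_self (a : ℕ) :
    gaussInt (wirtingerMonomial a a) = Real.pi * a.factorial := by
  have h := integral_norm_pow_mul_exp (2 * a)
  rw [show (((2 * a : ℕ) : ℝ) + 2) / 2 = a + 1 by push_cast; ring, Real.Gamma_nat_eq_factorial]
    at h
  have h' : gaussInt (wirtingerMonomial a a)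
      = ((∫ z : ℂ, ‖z‖ ^ (2 * a) * Real.exp (-‖z‖ ^ 2) : ℝ) : ℂ) := by
    rw [← integral_complex_ofReal]
    refine integral_congr_ae (.of_forall fun z => ?_)
    simp only [wirtingerMonomial, ← mul_pow, mul_comm (conj z), Complex.mul_conj,
      Complex.normSq_eq_norm_sq, Complex.ofReal_mul, Complex.ofReal_pow, pow_mul]
  rw [h', h]
  push_cast
  rfl

lemma gaussInt_wirtingerMonomial_of_ne {a b : ℕ} (hab : a ≠ b) :
    gaussInt (wirtingerMonomial a b) = 0 := by
  have hne : (b : ℂ) - a ≠ 0 := sub_ne_zero.2 (by exact_mod_cast hab.symm)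
  set t : ℝ := Real.pi / ((b : ℝ) - a) with ht
  set c : Circle := Circle.exp t with hc
  have hc' : conj (c : ℂ) ^ a * (c : ℂ) ^ b = -1 := by
    rw [hc, Circle.coe_exp, ← Complex.exp_conj, ← Complex.exp_nat_mul, ← Complex.exp_nat_mul,
      ← Complex.exp_add, ← Complex.exp_pi_mul_I]
    congr 1
    simp only [map_mul, Complex.conj_ofReal, Complex.conj_I, ht]
    push_cast
    field_simp
    ring
  have h := (rotation c).measurePreserving.integral_comp
    (rotation c).toHomeomorph.measurableEmbedding
    (fun z : ℂ => wirtingerMonomial a b z * (Real.exp (-‖z‖ ^ 2) : ℂ))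
  have h2 (z : ℂ) : wirtingerMonomial a b (rotation c z) * (Real.exp (-‖rotation c z‖ ^ 2) : ℂ)
      = - (wirtingerMonomial a b z * (Real.exp (-‖z‖ ^ 2) : ℂ)) := by
    rw [LinearIsometryEquiv.norm_map, rotation_apply]
    simp only [wirtingerMonomial, map_mul, mul_pow]
    linear_combination (conj z ^ a * z ^ b * (Real.exp (-‖z‖ ^ 2) : ℂ)) * hc'
  simp only [h2, integral_neg] at h
  exact self_eq_neg.1 h.symm

lemma gaussInt_id_mul {F : ℂ → ℂ} (hF : F ∈ wirtingerPoly) :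
    gaussInt (id * F) = gaussInt (dzbar F) := by
  have hid : (id : ℂ → ℂ) = wirtingerMonomial 0 1 := by
    funext z
    simp [wirtingerMonomial]
  have hid_mem : (id : ℂ → ℂ) ∈ wirtingerPoly := hid ▸ wirtingerMonomial_mem 0 1
  induction hF using wirtingerPoly_induction with
  | mono a b =>
    have h : id * wirtingerMonomial a b = wirtingerMonomial a (b + 1) := by
      funext z
      simp [wirtingerMonomial]
      ring
    rw [h, dzbar_wirtingerMonomial, gaussInt_smul]
    by_cases hab : a = b + 1
    · subst hab
      rw [Nat.add_sub_cancel, gaussInt_wirtingerMonomial_self, gaussInt_wirtingerMonomial_self,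
        Nat.factorial_succ]
      push_cast
      ring
    · rw [gaussInt_wirtingerMonomial_of_ne hab]
      rcases a with _ | a
      · simp
      · rw [Nat.add_sub_cancel, gaussInt_wirtingerMonomial_of_ne (by omega), mul_zero]
  | add F hF H hH h1 h2 =>
    rw [mul_add, gaussInt_add (mul_mem_wirtingerPoly hid_mem hF)
      (mul_mem_wirtingerPoly hid_mem hH), dzbar_add (differentiable_of_mem hF)
      (differentiable_of_mem hH), gaussInt_add (dzbar_mem hF) (dzbar_mem hH), h1, h2]
  | smul c F hF h =>
    rw [mul_smul_comm, gaussInt_smul, h, dzbar_smul c (differentiable_of_mem hF), gaussInt_smul]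

/-- `∂_{z̄}` is the adjoint of `z̄ − ∂_z` with respect to the Gaussian weight. -/
lemma gaussInt_conj_Tbar_mul {F H : ℂ → ℂ} (hF : F ∈ wirtingerPoly) (hH : H ∈ wirtingerPoly) :
    gaussInt (conj (Tbar F) * H) = gaussInt (conj F * dzbar H) := by
  have hcF := conj_mem hF
  have key : conj (Tbar F) * H + dzbar (conj F) * H = id * (conj F * H) := by
    rw [dzbar_conj (differentiable_of_mem hF)]
    funext z
    simp [Tbar]
    ring
  have h := gaussInt_id_mul (mul_mem_wirtingerPoly hcF hH)
  have hd := mul_mem_wirtingerPoly (dzbar_mem hcF) hH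
  rw [← key, gaussInt_add (mul_mem_wirtingerPoly (conj_mem (Tbar_mem hF)) hH) hd,
    dzbar_mul (differentiable_of_mem hcF) (differentiable_of_mem hH),
    gaussInt_add hd (mul_mem_wirtingerPoly hcF (dzbar_mem hH))] at h
  linear_combination h

lemma gaussInt_Tbar_iterate_zero (n m m' : ℕ) :
    gaussInt (conj (Tbar^[n + 1] (wirtingerMonomial 0 m')) * wirtingerMonomial 0 m) = 0 := by
  rw [Function.iterate_succ_apply',
    gaussInt_conj_Tbar_mul (Tbar_iterate_mem _ _) (wirtingerMonomial_mem _ _),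
    dzbar_wirtingerMonomial_zero, mul_zero, gaussInt_zero]

lemma gaussInt_Tbar_iterate (n m n' m' : ℕ) :
    gaussInt (conj (Tbar^[n'] (wirtingerMonomial 0 m')) * Tbar^[n] (wirtingerMonomial 0 m))
      = if n = n' ∧ m = m' then (Real.pi * n.factorial * m.factorial : ℂ) else 0 := by
  induction n' generalizing n with
  | zero =>
    rcases n with _ | n
    · have h : conj (wirtingerMonomial 0 m') * wirtingerMonomial 0 m = wirtingerMonomial m' m := by
        funext z
        simp [wirtingerMonomial]
      rw [Function.iterate_zero_apply, Function.iterate_zero_apply, h]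
      split_ifs with hm
      · rw [hm.2, gaussInt_wirtingerMonomial_self]
        simp
      · exact gaussInt_wirtingerMonomial_of_ne fun hm' => hm ⟨rfl, hm'.symm⟩
    · have h := congrArg conj (gaussInt_Tbar_iterate_zero n m' m)
      rw [← gaussInt_conj, map_mul, RingHomCompTriple.comp_apply, RingHom.id_apply, map_zero, mul_comm] at h
      simpa using h
  | succ n' ih =>
    rcases n with _ | n
    · simpa using gaussInt_Tbar_iterate_zero n' m m'
    · rw [Function.iterate_succ_apply' Tbar n',
        gaussInt_conj_Tbar_mul (Tbar_iterate_mem _ _) (Tbar_iterate_mem _ _),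
        dzbar_Tbar_iterate_succ, mul_smul_comm, gaussInt_smul, ih]
      simp only [Nat.add_right_cancel_iff]
      split_ifs
      · rw [Nat.factorial_succ]
        push_cast
        ring
      · simp

lemma conj_phi_mul_phi (n m n' m' : ℕ) (z : ℂ) :
    conj (phi n' m' z) * phi n m z
      = ((Real.sqrt (Real.pi * n'.factorial * m'.factorial) : ℂ)⁻¹
          * (Real.sqrt (Real.pi * n.factorial * m.factorial) : ℂ)⁻¹)
        * ((conj (Tbar^[n'] (wirtingerMonomial 0 m')) * Tbar^[n] (wirtingerMonomial 0 m)) z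
          * (Real.exp (-‖z‖ ^ 2) : ℂ)) := by
  have hmono (k : ℕ) : (fun w : ℂ => w ^ k) = wirtingerMonomial 0 k := by
    funext w
    simp [wirtingerMonomial]
  have hexp : (Real.exp (-‖z‖ ^ 2) : ℂ) = Complex.exp (-(Complex.normSq z : ℂ) / 2)
      * Complex.exp (-(Complex.normSq z : ℂ) / 2) := by
    rw [← Complex.exp_add, Complex.normSq_eq_norm_sq, Complex.ofReal_exp]
    congr 1
    push_cast
    ring
  have hconj : conj (Complex.exp (-(Complex.normSq z : ℂ) / 2))
      = Complex.exp (-(Complex.normSq z : ℂ) / 2) := by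
    rw [← Complex.exp_conj]
    simp [Complex.conj_ofNat]
  simp only [phi, hmono, map_mul, map_inv₀, Complex.conj_ofReal, hconj, hexp, Pi.mul_apply,
    Pi.conj_apply]
  ring

/-- the family `{φ_{n,m}}` is orthonormal in `L²(ℂ)`. -/
theorem stmt5 (n m n' m' : ℕ) :
    ∫ z : ℂ, (starRingEnd ℂ) (phi n' m' z) * phi n m z
      = if n = n' ∧ m = m' then 1 else 0 := by
  simp only [conj_phi_mul_phi]
  rw [integral_const_mul]
  change _ * gaussInt _ = _
  rw [gaussInt_Tbar_iterate]
  split_ifs with h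
  · obtain ⟨rfl, rfl⟩ := h
    have hpos : 0 < Real.pi * n.factorial * m.factorial := by positivity
    have hs : (Real.sqrt (Real.pi * n.factorial * m.factorial) : ℂ) ≠ 0 := by
      exact_mod_cast (Real.sqrt_pos.2 hpos).ne'
    have hsq : (Real.sqrt (Real.pi * n.factorial * m.factorial) : ℂ)
        * Real.sqrt (Real.pi * n.factorial * m.factorial)
        = Real.pi * n.factorial * m.factorial := by
      exact_mod_cast Real.mul_self_sqrt hpos.le
    rw [← hsq]
    field_simp
  · simp
end
end

section
/- Many-body pointwise density identity: let N ≥ 1, n ∈ ℕ, and let F : ℂ^N → ℂ be entire (holomorphic in each variable, e.g. a polynomial). Define Ψ̂ₙ = Π_{i=1}^{N} (z̄_i − ∂_{z_i})^n F, where (z̄_i − ∂_{z_i}) acts on the i-th variable. Then pointwise on ℂ^N: (n!)^{−N} |Ψ̂ₙ(z₁,…,z_N)|² e^{−(|z₁|²+⋯+|z_N|²)} = Π_{i=1}^{N} Lₙ(−∂_{z̄_i}∂_{z_i}) [ |F|² e^{−(|z₁|²+⋯+|z_N|²)} ](z₁,…,z_N), where Lₙ(−∂_{z̄_i}∂_{z_i})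 = Σ_{l=0}^{n} C(n,l)(∂_{z̄_i}∂_{z_i})^l/l! acts on the i-th variable and the differential operators for different i commute. -/
noncomputable section

/-- Wirtinger derivative `∂_{z_i}` in the `i`-th variable of `G : ℂ^N → ℂ`. -/
def dzi (N : ℕ) (i : Fin N) (G : (Fin N → ℂ) → ℂ) (z : Fin N → ℂ) : ℂ :=
  (1 / 2 : ℂ) * (fderiv ℝ G z (Pi.single i 1)
    - Complex.I * fderiv ℝ G z (Pi.single i Complex.I))

/-- Wirtinger derivative `∂_{z̄_i}` in the `i`-th variable. -/
def dzbari (N : ℕ) (i : Fin N) (G : (Fin N → ℂ) → ℂ) (z : Fin N → ℂ) : ℂ :=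
  (1 / 2 : ℂ) * (fderiv ℝ G z (Pi.single i 1)
    + Complex.I * fderiv ℝ G z (Pi.single i Complex.I))

/-- The operator `z̄_i − ∂_{z_i}` acting in the `i`-th variable. -/
def Ti (N : ℕ) (i : Fin N) (G : (Fin N → ℂ) → ℂ) : (Fin N → ℂ) → ℂ :=
  fun z => (starRingEnd ℂ) (z i) * G z - dzi N i G z

/-- Composition `op₀ ∘ op₁ ∘ ⋯ ∘ op_{N−1}` of a family of operators (they commute in all
uses below, so the order is irrelevant). -/
def applyAll {α : Type*} (N : ℕ) (ops : Fin N → (α → α)) : α → α :=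
  (List.ofFn ops).foldr (· ∘ ·) id

/-- The operator `Lₙ(−∂_{z̄_i}∂_{z_i}) = Σ_{l=0}^n C(n,l)(∂_{z̄_i}∂_{z_i})^l/l!`
acting in the `i`-th variable. -/
def LagOpC (N n : ℕ) (i : Fin N) (G : (Fin N → ℂ) → ℂ) : (Fin N → ℂ) → ℂ :=
  fun z => ∑ l ∈ Finset.range (n + 1), (n.choose l : ℂ) * (l.factorial : ℂ)⁻¹ *
    ((fun H => dzbari N i (dzi N i H))^[l] G) z

open scoped ContDiff

/-- Cauchy estimate: the derivative of an entire function is bounded on closed balls. -/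
theorem Differentiable.exists_norm_fderiv_le {E : Type*} [NormedAddCommGroup E] [NormedSpace ℂ E]
    [ProperSpace E] {f : E → ℂ} (hf : Differentiable ℂ f) (R : ℝ) :
    ∃ C, ∀ y ∈ Metric.closedBall (0 : E) R, ‖fderiv ℂ f y‖ ≤ C := by
  obtain ⟨C, hC⟩ := (isCompact_closedBall (0 : E) (R + 1)).exists_bound_of_continuousOn
    hf.continuous.continuousOn
  refine ⟨max C 0, fun y hy => ContinuousLinearMap.opNorm_le_bound _ (le_max_right _ _) fun v => ?_⟩
  rcases eq_or_ne v 0 with rfl | hv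
  · simp
  have hv' : 0 < ‖v‖ := norm_pos_iff.mpr hv
  have hline (t : ℂ) : HasDerivAt (fun t : ℂ => f (y + t • v)) (fderiv ℂ f (y + t • v) v) t := by
    have h : HasDerivAt (fun t : ℂ => y + t • v) v t := by
      simpa using ((hasDerivAt_id t).smul_const v).const_add y
    exact (hf _).hasFDerivAt.comp_hasDerivAt t h
  have key := Complex.norm_deriv_le_of_forall_mem_sphere_norm_le (c := 0) (R := ‖v‖⁻¹)
    (C := max C 0) (f := fun t : ℂ => f (y + t • v)) (inv_pos.mpr hv')
    (Differentiable.diffContOnCl fun t => (hline t).differentiableAt) (fun t ht => by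
      refine (hC _ ?_).trans (le_max_left _ _)
      rw [mem_closedBall_zero_iff] at hy ⊢
      rw [mem_sphere_zero_iff_norm] at ht
      refine (norm_add_le _ _).trans (add_le_add hy ?_)
      rw [norm_smul, ht, inv_mul_cancel₀ hv'.ne'])
  rw [(hline 0).deriv] at key
  simpa using key

/-- A directional derivative of an entire function on a finite dimensional space is entire. -/
theorem Differentiable.fderiv_apply_const {E : Type*} [NormedAddCommGroup E] [NormedSpace ℂ E]
    [FiniteDimensional ℂ E] {f : E → ℂ} (hf : Differentiable ℂ f) (v : E) :
    Differentiable ℂ fun x => fderiv ℂ f x v := by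
  have : ProperSpace E := FiniteDimensional.proper ℂ E
  borelize E
  have hcauchy (x : E) : fderiv ℂ f x v = (2 * Real.pi * Complex.I)⁻¹ *
      ∫ θ in (0 : ℝ)..2 * Real.pi, (_root_.deriv (circleMap 0 1) θ * (1 / circleMap 0 1 θ ^ 2)) •
        f (x + circleMap 0 1 θ • v) := by
    have hline (t : ℂ) : HasDerivAt (fun t : ℂ => f (x + t • v)) (fderiv ℂ f (x + t • v) v) t := by
      have h : HasDerivAt (fun t : ℂ => x + t • v) v t := by
        simpa using ((hasDerivAt_id t).smul_const v).const_add x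
      exact (hf _).hasFDerivAt.comp_hasDerivAt t h
    have h := DiffContOnCl.deriv_eq_smul_circleIntegral (c := 0) (R := 1)
      (f := fun t : ℂ => f (x + t • v)) one_pos
      (Differentiable.diffContOnCl fun t => (hline t).differentiableAt)
    rw [(hline 0).deriv, circleIntegral] at h
    simp only [sub_zero, zero_smul, add_zero, smul_eq_mul] at h
    rw [eq_inv_mul_iff_mul_eq₀ Complex.two_pi_I_ne_zero, ← h]
    simp only [smul_eq_mul, mul_assoc]
  simp_rw [hcauchy]
  intro x₀
  refine DifferentiableAt.const_mul ?_ _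
  set k : ℝ → ℂ := fun θ => _root_.deriv (circleMap 0 1) θ * (1 / circleMap 0 1 θ ^ 2) with hk
  have hkc : Continuous k := by
    simp only [hk, deriv_circleMap]
    have : ∀ θ, circleMap 0 1 θ ^ 2 ≠ 0 := fun θ => pow_ne_zero 2 (circleMap_ne_center one_ne_zero)
    fun_prop (disch := simpa using this)
  have hkn (θ : ℝ) : ‖k θ‖ = 1 := by simp [hk]
  obtain ⟨C, hC⟩ := hf.exists_norm_fderiv_le (‖x₀‖ + 1 + ‖v‖)
  refine (intervalIntegral.hasFDerivAt_integral_of_dominated_of_fderiv_le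
    (F := fun x θ => k θ • f (x + circleMap 0 1 θ • v))
    (F' := fun x θ => k θ • fderiv ℂ f (x + circleMap 0 1 θ • v))
    (bound := fun _ => C) (Metric.closedBall_mem_nhds x₀ one_pos) ?_ ?_ ?_ ?_ ?_ ?_
    ).differentiableAt
  · refine .of_forall fun x => Continuous.aestronglyMeasurable ?_
    have := hf.continuous
    fun_prop
  · refine Continuous.intervalIntegrable ?_ _ _
    have := hf.continuous
    fun_prop
  · have hm : Measurable fun θ : ℝ => fderiv ℂ f (x₀ + circleMap 0 1 θ • v) :=
      (measurable_fderiv ℂ f).comp (by fun_prop : Continuous _).measurable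
    exact hkc.aestronglyMeasurable.smul hm.stronglyMeasurable.aestronglyMeasurable
  · refine .of_forall fun θ _ x hx => ?_
    rw [norm_smul, hkn, one_mul]
    refine hC _ ?_
    rw [mem_closedBall_zero_iff]
    rw [mem_closedBall_iff_norm] at hx
    have h1 : ‖x‖ ≤ ‖x₀‖ + 1 := by
      have := norm_le_norm_add_norm_sub' x x₀
      linarith
    have h2 : ‖circleMap 0 1 θ • v‖ = ‖v‖ := by simp [norm_smul]
    have := norm_add_le x (circleMap 0 1 θ • v)
    linarith
  · simp
  · refine .of_forall fun θ _ x _ => ?_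
    have h : HasFDerivAt (fun x => x + circleMap 0 1 θ • v) (ContinuousLinearMap.id ℂ E) x :=
      (hasFDerivAt_id x).add_const _
    have h' := (hf (x + circleMap 0 1 θ • v)).hasFDerivAt.comp x h
    rw [ContinuousLinearMap.comp_id] at h'
    exact h'.const_smul (k θ)

/-- An entire function on a finite dimensional complex space is smooth. -/
theorem Differentiable.contDiff_of_finiteDimensional {E : Type*} [NormedAddCommGroup E]
    [NormedSpace ℂ E] [FiniteDimensional ℂ E] {f : E → ℂ} (hf : Differentiable ℂ f) :
    ContDiff ℂ ∞ f := by
  refine contDiff_infty.mpr fun n => ?_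
  induction n generalizing f with
  | zero => exact contDiff_zero.mpr hf.continuous
  | succ n ih =>
    push_cast
    exact contDiff_succ_iff_fderiv_apply.mpr ⟨hf, by simp, fun v => ih (hf.fderiv_apply_const v)⟩

theorem choose_three_term_recurrence (n l : ℕ) :
    ((n : ℂ) + 1) * ((n + 1).choose (l + 1) * ((l + 1).factorial : ℂ)⁻¹) =
      (2 * n + 1) * (n.choose (l + 1) * ((l + 1).factorial : ℂ)⁻¹) +
        n.choose l * (l.factorial : ℂ)⁻¹ -
        n * ((n - 1).choose (l + 1) * ((l + 1).factorial : ℂ)⁻¹) := by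
  have h1 : (((n + 1).choose (l + 1) : ℕ) : ℂ) = n.choose l + n.choose (l + 1) := by
    exact_mod_cast Nat.choose_succ_succ n l
  have h2 : ((n : ℂ) + 1) * n.choose l = (n + 1).choose (l + 1) * (l + 1) := by
    exact_mod_cast Nat.add_one_mul_choose_eq n l
  have h3 : (n : ℂ) * (n - 1).choose (l + 1) = (n - (l + 1)) * n.choose (l + 1) := by
    rcases n with _ | n
    · simp
    · have a : (((n + 1).choose (l + 1) : ℕ) : ℂ) = n.choose l + n.choose (l + 1) := by
        exact_mod_cast Nat.choose_succ_succ n l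
      have b : ((n : ℂ) + 1) * n.choose l = (n + 1).choose (l + 1) * (l + 1) := by
        exact_mod_cast Nat.add_one_mul_choose_eq n l
      rw [Nat.add_sub_cancel]
      push_cast
      linear_combination -b - (n + 1 : ℂ) * a
  have hf : (l.factorial : ℂ) ≠ 0 := by exact_mod_cast l.factorial_ne_zero
  have hl : (l : ℂ) + 1 ≠ 0 := by exact_mod_cast l.succ_ne_zero
  rw [Nat.factorial_succ]
  push_cast
  field_simp
  linear_combination (n + l + 2 : ℂ) * h1 + h2 + h3

/-- A sequence satisfying the three-term recurrence of the Laguerre polynomials `Lₙ(-X)` is given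
by these polynomials applied to its initial term. -/
theorem eq_sum_choose_of_laguerre_recurrence {M : Type*} [AddCommGroup M] [Module ℂ M]
    (X : M → M) (u p : ℕ → M)
    (hX : ∀ (s : Finset ℕ) (c : ℕ → ℂ), X (∑ l ∈ s, c l • u l) = ∑ l ∈ s, c l • u (l + 1))
    (h0 : p 0 = u 0)
    (hrec : ∀ n : ℕ, ((n : ℂ) + 1) • p (n + 1) =
      (2 * n + 1 : ℂ) • p n + X (p n) - (n : ℂ) • p (n - 1)) (n : ℕ) :
    p n = ∑ l ∈ Finset.range (n + 1), (n.choose l * (l.factorial : ℂ)⁻¹) • u l := by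
  suffices h : ∀ n K, n < K →
      p n = ∑ l ∈ Finset.range K, (n.choose l * (l.factorial : ℂ)⁻¹) • u l from
    h n _ n.lt_succ_self
  intro n
  induction n using Nat.strong_induction_on with
  | _ n ih =>
  intro K hK
  rcases n with _ | n
  · obtain ⟨K, rfl⟩ := Nat.exists_eq_succ_of_ne_zero hK.ne'
    simp [Finset.sum_range_succ', h0]
  · obtain ⟨K, rfl⟩ := Nat.exists_eq_succ_of_ne_zero (Nat.ne_zero_of_lt hK)
    have hn : (n : ℂ) + 1 ≠ 0 := by exact_mod_cast n.succ_ne_zero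
    refine (smul_right_injective M hn) ?_
    simp only
    have hXp : X (p n) =
        ∑ l ∈ Finset.range K, (n.choose l * (l.factorial : ℂ)⁻¹) • u (l + 1) := by
      rw [ih n n.lt_succ_self K (by omega), hX]
    rw [hrec, hXp, ih n n.lt_succ_self (K + 1) (by omega),
      ih (n - 1) (by omega) (K + 1) (by omega)]
    simp only [Finset.sum_range_succ', smul_add, Finset.smul_sum, smul_smul]
    simp only [choose_three_term_recurrence, sub_smul, add_smul, Finset.sum_sub_distrib,
      Finset.sum_add_distrib, Nat.choose_zero_right, Nat.factorial_zero, Nat.cast_one, inv_one,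
      mul_one, two_mul, one_smul]
    abel

section Wirtinger

variable {N : ℕ}

/-- The directional operator `½(∂_{x_i} + ε i ∂_{y_i})`: it is `∂_{z_i}` for `ε = -1` and
`∂_{z̄_i}` for `ε = 1`. -/
def wirtinger (ε : ℂ) (i : Fin N) (G : (Fin N → ℂ) → ℂ) (z : Fin N → ℂ) : ℂ :=
  (1 / 2 : ℂ) * (fderiv ℝ G z (Pi.single i 1)
    + ε * Complex.I * fderiv ℝ G z (Pi.single i Complex.I))

theorem dzi_eq_wirtinger : dzi N = wirtinger (-1) := by
  ext i G z
  simp only [dzi, wirtinger]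
  ring

theorem dzbari_eq_wirtinger : dzbari N = wirtinger 1 := by
  ext i G z
  simp only [dzbari, wirtinger, one_mul]

variable {G H : (Fin N → ℂ) → ℂ} {z : Fin N → ℂ}

theorem ContDiff.wirtinger (hG : ContDiff ℝ ∞ G) (ε : ℂ) (i : Fin N) :
    ContDiff ℝ ∞ (wirtinger ε i G) := by
  have h (v : Fin N → ℂ) : ContDiff ℝ ∞ fun z => fderiv ℝ G z v :=
    (hG.fderiv_right (m := ∞) (by simp)).clm_apply contDiff_const
  exact contDiff_const.mul ((h _).add (contDiff_const.mul (h _)))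

theorem wirtinger_sub (ε : ℂ) (i : Fin N) (hG : DifferentiableAt ℝ G z)
    (hH : DifferentiableAt ℝ H z) :
    wirtinger ε i (fun w => G w - H w) z = wirtinger ε i G z - wirtinger ε i H z := by
  simp only [wirtinger, fderiv_fun_sub hG hH, _root_.sub_apply]
  ring

theorem wirtinger_mul (ε : ℂ) (i : Fin N) (hG : DifferentiableAt ℝ G z)
    (hH : DifferentiableAt ℝ H z) :
    wirtinger ε i (fun w => G w * H w) z =
      wirtinger ε i G z * H z + G z * wirtinger ε i H z := by
  simp only [wirtinger, fderiv_fun_mul hG hH, _root_.add_apply,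
    _root_.smul_apply, smul_eq_mul]
  ring

theorem wirtinger_const_mul (ε : ℂ) (i : Fin N) (c : ℂ) (hG : DifferentiableAt ℝ G z) :
    wirtinger ε i (fun w => c * G w) z = c * wirtinger ε i G z := by
  simp only [wirtinger, fderiv_const_mul hG, _root_.smul_apply, smul_eq_mul]
  ring

theorem wirtinger_sum {ι : Type*} (ε : ℂ) (i : Fin N) (s : Finset ι)
    {G : ι → (Fin N → ℂ) → ℂ} (hG : ∀ j ∈ s, DifferentiableAt ℝ (G j) z) :
    wirtinger ε i (fun w => ∑ j ∈ s, G j w) z = ∑ j ∈ s, wirtinger ε i (G j) z := by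
  simp only [wirtinger, fderiv_fun_sum hG, _root_.sum_apply, Finset.mul_sum,
    mul_add, Finset.sum_add_distrib]

theorem wirtinger_conj (ε : ℂ) (i : Fin N) (hG : DifferentiableAt ℝ G z) :
    wirtinger ε i (fun w => (starRingEnd ℂ) (G w)) z =
      (starRingEnd ℂ) (wirtinger (-(starRingEnd ℂ) ε) i G z) := by
  have h : HasFDerivAt (fun w => (starRingEnd ℂ) (G w))
      ((Complex.conjCLE : ℂ →L[ℝ] ℂ).comp (fderiv ℝ G z)) z :=
    Complex.conjCLE.hasFDerivAt.comp z hG.hasFDerivAt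
  simp [wirtinger, h.fderiv, Complex.conj_ofNat]

theorem wirtinger_cexp (ε : ℂ) (i : Fin N) (hG : DifferentiableAt ℝ G z) :
    wirtinger ε i (fun w => Complex.exp (G w)) z = wirtinger ε i G z * Complex.exp (G z) := by
  simp only [wirtinger, hG.hasFDerivAt.cexp.fderiv, _root_.smul_apply, smul_eq_mul]
  ring

theorem wirtinger_coord (ε : ℂ) (i j : Fin N) :
    wirtinger ε i (fun w => w j) z = if i = j then (1 - ε) / 2 else 0 := by
  have h : HasFDerivAt (fun w : Fin N → ℂ => w j)
      (ContinuousLinearMap.proj (R := ℝ) (φ := fun _ : Fin N => ℂ) j) z := hasFDerivAt_apply j z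
  simp only [wirtinger, h.fderiv, ContinuousLinearMap.proj_apply]
  rcases eq_or_ne i j with rfl | hij
  · simp only [Pi.single_eq_same, if_true]
    linear_combination (ε / 2) * Complex.I_mul_I
  · simp [hij]

theorem wirtinger_comm (hG : ContDiff ℝ ∞ G) (ε δ : ℂ) (i j : Fin N) :
    wirtinger ε i (wirtinger δ j G) = wirtinger δ j (wirtinger ε i G) := by
  have hd : Differentiable ℝ (fderiv ℝ G) :=
    (hG.fderiv_right (m := ∞) (by simp)).differentiable (by simp)
  have hsym (z v w) : fderiv ℝ (fderiv ℝ G) z v w = fderiv ℝ (fderiv ℝ G) z w v :=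
    (hG.contDiffAt.isSymmSndFDerivAt (by
      rw [minSmoothness_of_isRCLikeNormedField]
      exact WithTop.coe_le_coe.mpr (le_top : (2 : ℕ∞) ≤ ⊤))) v w
  have key (ε : ℂ) (i : Fin N) (z v) : fderiv ℝ (wirtinger ε i G) z v =
      (1 / 2 : ℂ) * (fderiv ℝ (fderiv ℝ G) z v (Pi.single i 1)
        + ε * Complex.I * fderiv ℝ (fderiv ℝ G) z v (Pi.single i Complex.I)) := by
    have h (w : Fin N → ℂ) : HasFDerivAt (fun z => fderiv ℝ G z w)
        ((fderiv ℝ (fderiv ℝ G) z).flip w) z := by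
      simpa using! (hd z).hasFDerivAt.clm_apply (hasFDerivAt_const w z)
    have := ((h (Pi.single i 1)).add ((h (Pi.single i Complex.I)).const_mul
      (ε * Complex.I))).const_mul (1 / 2 : ℂ)
    have e : fderiv ℝ (wirtinger ε i G) z = _ := this.fderiv
    rw [e]
    simp [mul_add]
  ext z
  rw [wirtinger, wirtinger.eq_def δ j, key, key, key, key, hsym z (Pi.single i 1),
    hsym z (Pi.single i 1), hsym z (Pi.single i Complex.I), hsym z (Pi.single i Complex.I)]
  ring

theorem Differentiable.wirtinger_one_eq_zero (hG : Differentiable ℂ G) (i : Fin N) :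
    wirtinger 1 i G = 0 := by
  ext z
  have h := (hG z).hasFDerivAt.restrictScalars ℝ
  have hs : (Pi.single i Complex.I : Fin N → ℂ) = Complex.I • Pi.single i 1 := by
    rw [← Pi.single_smul, smul_eq_mul, mul_one]
  simp only [wirtinger, h.fderiv, ContinuousLinearMap.coe_restrictScalars', hs, map_smul,
    smul_eq_mul, Pi.zero_apply]
  linear_combination (fderiv ℂ G z (Pi.single i 1) / 2) * Complex.I_mul_I

theorem contDiff_coord (i : Fin N) : ContDiff ℝ ∞ fun w : Fin N → ℂ => w i :=
  contDiff_apply ℝ ℂ i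

theorem ContDiff.conj (hG : ContDiff ℝ ∞ G) : ContDiff ℝ ∞ fun w => (starRingEnd ℂ) (G w) :=
  Complex.conjCLE.contDiff.comp hG

theorem dzi_conj (i : Fin N) (hG : DifferentiableAt ℝ G z) :
    dzi N i (fun w => (starRingEnd ℂ) (G w)) z = (starRingEnd ℂ) (dzbari N i G z) := by
  rw [dzi_eq_wirtinger, dzbari_eq_wirtinger, wirtinger_conj _ _ hG]
  simp

theorem dzbari_conj (i : Fin N) (hG : DifferentiableAt ℝ G z) :
    dzbari N i (fun w => (starRingEnd ℂ) (G w)) z = (starRingEnd ℂ) (dzi N i G z) := by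
  rw [dzi_eq_wirtinger, dzbari_eq_wirtinger, wirtinger_conj _ _ hG]
  simp

theorem dzi_coord (i j : Fin N) : dzi N i (fun w => w j) z = if i = j then 1 else 0 := by
  rw [dzi_eq_wirtinger, wirtinger_coord]
  norm_num

/-- The Gaussian weight `e^{-Σ|z_i|²}`. -/
def gaussianWeight (N : ℕ) (w : Fin N → ℂ) : ℂ :=
  Complex.exp (-(∑ i, (Complex.normSq (w i) : ℂ)))

theorem gaussianWeight_eq (N : ℕ) :
    gaussianWeight N = fun w => Complex.exp (∑ i, -1 * ((starRingEnd ℂ) (w i) * w i)) := by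
  ext w
  simp [gaussianWeight, Complex.normSq_eq_conj_mul_self]

theorem contDiff_gaussianWeight (N : ℕ) : ContDiff ℝ ∞ (gaussianWeight N) := by
  rw [gaussianWeight_eq]
  exact (ContDiff.sum fun i _ => contDiff_const.mul
    ((contDiff_coord i).conj.mul (contDiff_coord i))).cexp

theorem wirtinger_gaussianWeight (ε : ℂ) (i : Fin N) :
    wirtinger ε i (gaussianWeight N) z =
      -((1 + ε) / 2 * z i + (1 - ε) / 2 * (starRingEnd ℂ) (z i)) * gaussianWeight N z := by
  have hc (j : Fin N) : Differentiable ℝ fun w : Fin N → ℂ => w j :=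
    (contDiff_coord j).differentiable (by simp)
  have hs (j : Fin N) : Differentiable ℝ fun w : Fin N → ℂ => (starRingEnd ℂ) (w j) :=
    (contDiff_coord j).conj.differentiable (by simp)
  have hm (j : Fin N) : Differentiable ℝ fun w : Fin N → ℂ => (starRingEnd ℂ) (w j) * w j :=
    (hs j).mul (hc j)
  rw [gaussianWeight_eq, wirtinger_cexp _ _
    (DifferentiableAt.fun_sum fun j _ => ((hm j).const_mul _).differentiableAt),
    wirtinger_sum _ _ _ fun j _ => ((hm j).const_mul _).differentiableAt]
  congr 1
  have key (j : Fin N) : wirtinger ε i (fun w => -1 * ((starRingEnd ℂ) (w j) * w j)) z =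
      if i = j then -((1 + ε) / 2 * z j + (1 - ε) / 2 * (starRingEnd ℂ) (z j)) else 0 := by
    rw [wirtinger_const_mul _ _ _ (hm j z), wirtinger_mul _ _ (hs j z) (hc j z),
      wirtinger_conj _ _ (hc j z), wirtinger_coord, wirtinger_coord]
    split_ifs
    · simp only [map_div₀, map_sub, map_one, map_neg, Complex.conj_conj, Complex.conj_ofNat]
      ring
    · simp
  simp only [key, Finset.sum_ite_eq, Finset.mem_univ, if_true]

theorem dzi_gaussianWeight (i : Fin N) :
    dzi N i (gaussianWeight N) z = -(starRingEnd ℂ) (z i) * gaussianWeight N z := by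
  rw [dzi_eq_wirtinger, wirtinger_gaussianWeight]
  ring

theorem dzbari_gaussianWeight (i : Fin N) :
    dzbari N i (gaussianWeight N) z = -z i * gaussianWeight N z := by
  rw [dzbari_eq_wirtinger, wirtinger_gaussianWeight]
  ring

theorem ContDiff.dzi (hG : ContDiff ℝ ∞ G) (i : Fin N) : ContDiff ℝ ∞ (dzi N i G) := by
  rw [dzi_eq_wirtinger]
  exact hG.wirtinger _ _

theorem ContDiff.dzbari (hG : ContDiff ℝ ∞ G) (i : Fin N) : ContDiff ℝ ∞ (dzbari N i G) := by
  rw [dzbari_eq_wirtinger]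
  exact hG.wirtinger _ _

theorem ContDiff.Ti (hG : ContDiff ℝ ∞ G) (i : Fin N) : ContDiff ℝ ∞ (Ti N i G) :=
  ((contDiff_coord i).conj.mul hG).sub (hG.dzi i)

theorem ContDiff.iterate_Ti (hG : ContDiff ℝ ∞ G) (i : Fin N) (n : ℕ) :
    ContDiff ℝ ∞ ((_root_.Ti N i)^[n] G) := by
  induction n with
  | zero => exact hG
  | succ n ih =>
    rw [Function.iterate_succ_apply']
    exact ih.Ti i

theorem dzbari_Ti (hG : ContDiff ℝ ∞ G) (i j : Fin N) :
    dzbari N j (Ti N i G) =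
      fun w => (if j = i then G w else 0) + Ti N i (dzbari N j G) w := by
  ext w
  have hz : DifferentiableAt ℝ (fun w : Fin N → ℂ => (starRingEnd ℂ) (w i)) w :=
    (contDiff_coord i).conj.contDiffAt.differentiableAt (by simp)
  have hc : DifferentiableAt ℝ (fun w : Fin N → ℂ => w i) w :=
    (contDiff_coord i).contDiffAt.differentiableAt (by simp)
  have hGd : DifferentiableAt ℝ G w := hG.contDiffAt.differentiableAt (by simp)
  have hD : DifferentiableAt ℝ (dzi N i G) w := (hG.dzi i).contDiffAt.differentiableAt (by simp)
  have h1 : dzbari N j (Ti N i G) w = dzbari N j (fun w => (starRingEnd ℂ) (w i)) w * G w +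
      (starRingEnd ℂ) (w i) * dzbari N j G w - dzbari N j (dzi N i G) w := by
    simp only [dzbari_eq_wirtinger]
    exact (wirtinger_sub 1 j (hz.mul hGd) hD).trans
      (congrArg (· - _) (wirtinger_mul 1 j hz hGd))
  have h2 : dzbari N j (dzi N i G) = dzi N i (dzbari N j G) := by
    simp only [dzbari_eq_wirtinger, dzi_eq_wirtinger]
    exact wirtinger_comm hG _ _ _ _
  rw [h1, h2, dzbari_conj _ hc, dzi_coord, Ti]
  split_ifs <;> simp [add_sub_assoc]

theorem Ti_const_mul (hG : ContDiff ℝ ∞ G) (i : Fin N) (c : ℂ) :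
    Ti N i (fun w => c * G w) = fun w => c * Ti N i G w := by
  ext w
  simp only [Ti, dzi_eq_wirtinger]
  rw [wirtinger_const_mul _ _ _ (hG.contDiffAt.differentiableAt (by simp))]
  ring

theorem Ti_zero (i : Fin N) : Ti N i 0 = 0 := by
  ext w
  simp [Ti, dzi]

theorem dzbari_iterate_Ti_of_ne {i j : Fin N} (hij : j ≠ i) (hG : ContDiff ℝ ∞ G)
    (h : dzbari N j G = 0) (n : ℕ) : dzbari N j ((Ti N i)^[n] G) = 0 := by
  induction n with
  | zero => exact h
  | succ n ih =>
    rw [Function.iterate_succ_apply', dzbari_Ti (hG.iterate_Ti i n), ih, Ti_zero]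
    ext w
    simp [hij]

theorem dzbari_iterate_Ti {i : Fin N} (hG : ContDiff ℝ ∞ G) (h : dzbari N i G = 0) (n : ℕ) :
    dzbari N i ((Ti N i)^[n] G) = fun w => (n : ℂ) * (Ti N i)^[n - 1] G w := by
  induction n with
  | zero =>
    ext w
    simp [h]
  | succ n ih =>
    rw [Function.iterate_succ_apply', dzbari_Ti (hG.iterate_Ti i n), ih,
      Ti_const_mul (hG.iterate_Ti i (n - 1))]
    ext w
    rcases n with _ | n
    · simp
    · simp only [if_true, Nat.add_sub_cancel, ← Function.iterate_succ_apply' (Ti N i)]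
      push_cast
      ring

/-- The mixed Landau-level density
`conj((z̄_i - ∂_{z_i})^m G) · (z̄_i - ∂_{z_i})^n G · e^{-Σ|z_j|²}`. -/
def mixedDensity (i : Fin N) (G : (Fin N → ℂ) → ℂ) (m n : ℕ) (w : Fin N → ℂ) : ℂ :=
  (starRingEnd ℂ) ((Ti N i)^[m] G w) * (Ti N i)^[n] G w * gaussianWeight N w

theorem contDiff_mixedDensity (hG : ContDiff ℝ ∞ G) (i : Fin N) (m n : ℕ) :
    ContDiff ℝ ∞ (mixedDensity i G m n) :=
  ((hG.iterate_Ti i m).conj.mul (hG.iterate_Ti i n)).mul (contDiff_gaussianWeight N)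

theorem wirtinger_mixedDensity (ε : ℂ) {i : Fin N} (hG : ContDiff ℝ ∞ G) (m n : ℕ) :
    wirtinger ε i (mixedDensity i G m n) z =
      (wirtinger ε i (fun w => (starRingEnd ℂ) ((Ti N i)^[m] G w)) z * (Ti N i)^[n] G z +
        (starRingEnd ℂ) ((Ti N i)^[m] G z) * wirtinger ε i ((Ti N i)^[n] G) z) *
          gaussianWeight N z +
        (starRingEnd ℂ) ((Ti N i)^[m] G z) * (Ti N i)^[n] G z *
          wirtinger ε i (gaussianWeight N) z := by
  have h1 : DifferentiableAt ℝ (fun w => (starRingEnd ℂ) ((Ti N i)^[m] G w)) z :=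
    (hG.iterate_Ti i m).conj.contDiffAt.differentiableAt (by simp)
  have h2 : DifferentiableAt ℝ ((Ti N i)^[n] G) z :=
    (hG.iterate_Ti i n).contDiffAt.differentiableAt (by simp)
  have h3 : DifferentiableAt ℝ (gaussianWeight N) z :=
    (contDiff_gaussianWeight N).contDiffAt.differentiableAt (by simp)
  exact (wirtinger_mul ε i (h1.mul h2) h3).trans
    (congrArg (fun x => x * _ + _) (wirtinger_mul ε i h1 h2))

theorem dzi_iterate_Ti (i : Fin N) (n : ℕ) :
    dzi N i ((Ti N i)^[n] G) z =
      (starRingEnd ℂ) (z i) * (Ti N i)^[n] G z - (Ti N i)^[n + 1] G z := by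
  rw [Function.iterate_succ_apply', Ti]
  ring

theorem dzi_mixedDensity {i : Fin N} (hG : ContDiff ℝ ∞ G) (h : dzbari N i G = 0) (m n : ℕ) :
    dzi N i (mixedDensity i G m n) =
      fun w => (m : ℂ) * mixedDensity i G (m - 1) n w - mixedDensity i G m (n + 1) w := by
  ext w
  have h1 : DifferentiableAt ℝ ((Ti N i)^[m] G) w :=
    (hG.iterate_Ti i m).contDiffAt.differentiableAt (by simp)
  rw [dzi_eq_wirtinger, wirtinger_mixedDensity _ hG, ← dzi_eq_wirtinger, dzi_conj _ h1,
    dzbari_iterate_Ti hG h, dzi_iterate_Ti, dzi_gaussianWeight]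
  simp only [mixedDensity, map_mul, map_natCast]
  ring

theorem dzbari_mixedDensity {i : Fin N} (hG : ContDiff ℝ ∞ G) (h : dzbari N i G = 0)
    (m n : ℕ) :
    dzbari N i (mixedDensity i G m n) =
      fun w => (n : ℂ) * mixedDensity i G m (n - 1) w - mixedDensity i G (m + 1) n w := by
  ext w
  have h1 : DifferentiableAt ℝ ((Ti N i)^[m] G) w :=
    (hG.iterate_Ti i m).contDiffAt.differentiableAt (by simp)
  rw [dzbari_eq_wirtinger, wirtinger_mixedDensity _ hG, ← dzbari_eq_wirtinger,
    dzbari_conj _ h1, dzbari_iterate_Ti hG h, dzi_iterate_Ti, dzbari_gaussianWeight]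
  simp only [mixedDensity, map_mul, map_sub, Complex.conj_conj]
  ring

theorem dzbari_dzi_mixedDensity {i : Fin N} (hG : ContDiff ℝ ∞ G) (h : dzbari N i G = 0)
    (n : ℕ) :
    dzbari N i (dzi N i (mixedDensity i G n n)) =
      fun w => (n : ℂ) ^ 2 * mixedDensity i G (n - 1) (n - 1) w -
        (2 * n + 1) * mixedDensity i G n n w + mixedDensity i G (n + 1) (n + 1) w := by
  ext w
  have hd (m n : ℕ) : DifferentiableAt ℝ (mixedDensity i G m n) w :=
    (contDiff_mixedDensity hG i m n).contDiffAt.differentiableAt (by simp)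
  rw [dzi_mixedDensity hG h, dzbari_eq_wirtinger,
    wirtinger_sub _ _ ((hd _ _).const_mul _) (hd _ _), wirtinger_const_mul _ _ _ (hd _ _),
    ← dzbari_eq_wirtinger, dzbari_mixedDensity hG h, dzbari_mixedDensity hG h]
  rcases n with _ | n
  · simp only [Nat.cast_zero, zero_add]
    push_cast
    ring
  · simp only [Nat.add_sub_cancel]
    push_cast
    ring

theorem dzbari_dzi_sum (i : Fin N) {u : ℕ → (Fin N → ℂ) → ℂ} (hu : ∀ l, ContDiff ℝ ∞ (u l))
    (s : Finset ℕ) (c : ℕ → ℂ) :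
    dzbari N i (dzi N i (∑ l ∈ s, c l • u l)) =
      ∑ l ∈ s, c l • dzbari N i (dzi N i (u l)) := by
  have hsum (ε : ℂ) {u : ℕ → (Fin N → ℂ) → ℂ} (hu : ∀ l, ContDiff ℝ ∞ (u l)) :
      wirtinger ε i (∑ l ∈ s, c l • u l) = ∑ l ∈ s, c l • wirtinger ε i (u l) := by
    ext w
    have hd (l : ℕ) : DifferentiableAt ℝ (u l) w := (hu l).contDiffAt.differentiableAt (by simp)
    have e : (∑ l ∈ s, c l • u l) = fun w => ∑ l ∈ s, c l * u l w := by
      ext w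
      simp
    rw [e, wirtinger_sum _ _ _ fun l _ => (hd l).const_mul _]
    simp [wirtinger_const_mul _ _ _ (hd _)]
  rw [dzi_eq_wirtinger, dzbari_eq_wirtinger, hsum _ hu, hsum _ fun l => (hu l).wirtinger _ _]

/-- One-variable density identity for a function holomorphic in the `i`-th variable. -/
theorem LagOpC_mixedDensity {i : Fin N} (hG : ContDiff ℝ ∞ G) (h : dzbari N i G = 0)
    (n : ℕ) (c : ℂ) :
    LagOpC N n i (fun w => c * mixedDensity i G 0 0 w) =
      fun w => c * ((n.factorial : ℂ)⁻¹ * mixedDensity i G n n w) := by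
  set X : ((Fin N → ℂ) → ℂ) → (Fin N → ℂ) → ℂ := fun H => dzbari N i (dzi N i H) with hXdef
  set u : ℕ → (Fin N → ℂ) → ℂ := fun l => X^[l] fun w => c * mixedDensity i G 0 0 w with hu
  have husucc (l : ℕ) : X (u l) = u (l + 1) := (Function.iterate_succ_apply' X l _).symm
  have hsmooth (l : ℕ) : ContDiff ℝ ∞ (u l) := by
    induction l with
    | zero => exact contDiff_const.mul (contDiff_mixedDensity hG i 0 0)
    | succ l ih =>
      rw [← husucc]
      exact (ih.dzi i).dzbari i
  have key := eq_sum_choose_of_laguerre_recurrence X u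
    (fun n w => c * ((n.factorial : ℂ)⁻¹ * mixedDensity i G n n w))
    (fun s a => by simpa only [← husucc] using dzbari_dzi_sum i hsmooth s a)
    (by simp [hu]) (fun n => by
      have hX1 : X (fun w => c * ((n.factorial : ℂ)⁻¹ * mixedDensity i G n n w)) =
          (c * (n.factorial : ℂ)⁻¹) • X (mixedDensity i G n n) := by
        simpa [← mul_assoc, Pi.smul_def] using! dzbari_dzi_sum i
          (u := fun _ => mixedDensity i G n n) (fun _ => contDiff_mixedDensity hG i n n) {0}
          (fun _ => c * (n.factorial : ℂ)⁻¹)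
      rw [hX1, hXdef]
      simp only [dzbari_dzi_mixedDensity hG h]
      ext w
      simp only [Pi.add_apply, Pi.sub_apply, Pi.smul_apply, smul_eq_mul]
      rcases n with _ | n
      · simp
        ring
      · have hf : (n.factorial : ℂ) ≠ 0 := by exact_mod_cast n.factorial_ne_zero
        have hn : (n : ℂ) + 1 ≠ 0 := by exact_mod_cast n.succ_ne_zero
        have hn' : (n : ℂ) + 1 + 1 ≠ 0 := by exact_mod_cast (n + 1).succ_ne_zero
        simp only [Nat.add_sub_cancel, Nat.factorial_succ]
        push_cast
        field_simp
        ring) n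
  rw [key]
  ext w
  simp [LagOpC, hu, hXdef]

theorem foldr_Ti_foldr_LagOpC (n : ℕ) {F : (Fin N → ℂ) → ℂ} (hF : ContDiff ℝ ∞ F)
    (hF' : ∀ i, dzbari N i F = 0) (L : List (Fin N)) (hL : L.Nodup) :
    ContDiff ℝ ∞ ((L.map fun i => (Ti N i)^[n]).foldr (· ∘ ·) id F) ∧
    (∀ j ∉ L, dzbari N j ((L.map fun i => (Ti N i)^[n]).foldr (· ∘ ·) id F) = 0) ∧
    (L.map fun i => LagOpC N n i).foldr (· ∘ ·) id
        (fun w => (starRingEnd ℂ) (F w) * F w * gaussianWeight N w) =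
      fun w => ((n.factorial : ℂ) ^ L.length)⁻¹ *
        ((starRingEnd ℂ) ((L.map fun i => (Ti N i)^[n]).foldr (· ∘ ·) id F w) *
          (L.map fun i => (Ti N i)^[n]).foldr (· ∘ ·) id F w * gaussianWeight N w) := by
  induction L with
  | nil => exact ⟨hF, fun j _ => hF' j, by simp⟩
  | cons i L ih =>
    rw [List.nodup_cons] at hL
    obtain ⟨h1, h2, h3⟩ := ih hL.2
    simp only [List.map_cons, List.foldr_cons, Function.comp_apply, List.length_cons]
    refine ⟨h1.iterate_Ti i n, fun j hj => ?_, ?_⟩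
    · rw [List.mem_cons, not_or] at hj
      exact dzbari_iterate_Ti_of_ne hj.1 h1 (h2 j hj.2) n
    · rw [h3]
      refine (LagOpC_mixedDensity h1 (h2 i hL.1) n _).trans ?_
      ext w
      rw [mixedDensity, pow_succ, mul_inv]
      ring

end Wirtinger

/-- many-body pointwise density identity: for entire `F : ℂ^N → ℂ` and
`Ψ̂ₙ = Π_i (z̄_i − ∂_{z_i})^n F`, pointwise on `ℂ^N`,
`(n!)^{−N} |Ψ̂ₙ|² e^{−Σ|z_i|²} = Π_i Lₙ(−∂_{z̄_i}∂_{z_i}) [|F|² e^{−Σ|z_i|²}]`. -/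
theorem stmt16 (N n : ℕ) (hN : 1 ≤ N) (F : (Fin N → ℂ) → ℂ) (hF : Differentiable ℂ F)
    (z : Fin N → ℂ) :
    ((n.factorial : ℂ) ^ N)⁻¹
        * (starRingEnd ℂ) (applyAll N (fun i => (Ti N i)^[n]) F z)
        * applyAll N (fun i => (Ti N i)^[n]) F z
        * Complex.exp (-(∑ i, (Complex.normSq (z i) : ℂ)))
      = applyAll N (fun i => LagOpC N n i)
          (fun w => (starRingEnd ℂ) (F w) * F w
            * Complex.exp (-(∑ i, (Complex.normSq (w i) : ℂ)))) z := by
  obtain ⟨-, -, h⟩ := foldr_Ti_foldr_LagOpC n (hF.contDiff_of_finiteDimensional.restrict_scalars ℝ)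
    (fun i => by rw [dzbari_eq_wirtinger]; exact hF.wirtinger_one_eq_zero i)
    (List.finRange N) (List.nodup_finRange N)
  simp only [applyAll, List.ofFn_eq_map]
  refine Eq.trans ?_ (congrFun h z).symm
  rw [List.length_finRange, gaussianWeight]
  ring
end
end
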